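/- arXiv:2502.00311 — 5 statements merged into one kernel-verified Lean document; each statement's English description precedes it below -/
import Mathlib

section
/- Let d = c·m and s = c·s_c for positive integers c, m, s_c with s_c ≤ m, and let G ∈ ℝ^d have all entries nonzero with pairwise distinct absolute values. Let G̃' be the chunk-based s-sparsification of G and G̃ = Sparsify_s(G) the global s-sparsification. If every index j in the symmetric difference supp(G̃) Δ supp(G̃') satisfies G_j² ≤ ‖G̃'‖₂²/s, then ‖G̃' − G̃‖₂² ≤ 2·(1 − s/d)·‖G̃'‖₂². -/
open Finset

/-- Support of a vector: the set of indices with nonzero entries. -/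
noncomputable def supp {d : ℕ} (y : Fin d → ℝ) : Finset (Fin d) :=
  Finset.univ.filter (fun i => y i ≠ 0)

/-- `IsSparsify s x y` : `y` is obtained from `x` by keeping the `s` entries of
largest absolute value and setting all other entries to zero. -/
def IsSparsify {d : ℕ} (s : ℕ) (x y : Fin d → ℝ) : Prop :=
  ∃ S : Finset (Fin d), S.card = s ∧ (∀ i ∈ S, ∀ j ∉ S, |x j| < |x i|) ∧
    y = fun i => if i ∈ S then x i else 0

/-- `IsChunkSparsify c m sc x y` : partitioning `x : ℝ^(c*m)` into `c` consecutive
chunks of size `m` (chunk of index `j` is `j / m`), `y` is obtained by keeping, within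
each chunk, the `sc` entries of largest absolute value and zeroing the rest. -/
def IsChunkSparsify (c m sc : ℕ) (x y : Fin (c * m) → ℝ) : Prop :=
  ∃ S : Finset (Fin (c * m)),
    (∀ i < c, (S.filter (fun j : Fin (c * m) => (j : ℕ) / m = i)).card = sc) ∧
    (∀ j ∈ S, ∀ j' ∉ S, (j : ℕ) / m = (j' : ℕ) / m → |x j'| < |x j|) ∧
    y = fun j => if j ∈ S then x j else 0

theorem supp_ite_mem {d : ℕ} {x : Fin d → ℝ} (hx : ∀ j, x j ≠ 0) (S : Finset (Fin d)) :
    supp (fun j => if j ∈ S then x j else 0) = S := by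
  ext j
  simp [supp, hx]

theorem card_chunk_le {c m : ℕ} (hm : 0 < m) (S : Finset (Fin (c * m))) (i : ℕ) :
    (S.filter (fun j : Fin (c * m) => (j : ℕ) / m = i)).card ≤ m := by
  calc _ ≤ (Finset.range m).card := by
        refine Finset.card_le_card_of_injOn (fun j => (j : ℕ) % m) ?_ ?_
        · intro j _
          simpa using Nat.mod_lt _ hm
        · intro j hj j' hj' h
          simp only [Finset.coe_filter, Set.mem_ofPred_eq] at hj hj' h
          ext
          rw [← Nat.div_add_mod (j : ℕ) m, ← Nat.div_add_mod (j' : ℕ) m, hj.2, hj'.2, h]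
    _ = m := Finset.card_range m

theorem card_eq_sum_card_chunk {c m : ℕ} (S : Finset (Fin (c * m))) :
    S.card = ∑ i ∈ Finset.range c, (S.filter (fun j : Fin (c * m) => (j : ℕ) / m = i)).card := by
  refine Finset.card_eq_sum_card_fiberwise fun j _ => ?_
  simpa using Nat.div_lt_of_lt_mul (mul_comm c m ▸ j.isLt)

/-- If `B ⊆ A` whenever `A` is not contained in `B`, then the
size of the difference `A \ B` is bounded by the chord of `a ↦ max (a - B.card) 0` on `[0, m]`. -/
theorem mul_card_sdiff_add_le {α : Type*} [DecidableEq α] {A B : Finset α} {m : ℕ}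
    (hA : A.card ≤ m) (hB : B.card ≤ m) (h : (A \ B).Nonempty → B ⊆ A) :
    m * (A \ B).card + B.card * A.card ≤ m * A.card := by
  rcases (A \ B).eq_empty_or_nonempty with h0 | h1
  · simpa [h0] using Nat.mul_le_mul_right _ hB
  · have hcard := Finset.card_sdiff_add_card_eq_card (h h1)
    nlinarith

/-- The number of globally selected indices that are missed by the chunk-based selection. -/
theorem mul_card_sdiff_chunk_add_le {c m sc : ℕ} (hm : 0 < m) (hscm : sc ≤ m)
    {x : Fin (c * m) → ℝ} {S T : Finset (Fin (c * m))}
    (hS : ∀ i ∈ S, ∀ j ∉ S, |x j| < |x i|)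
    (hTcard : ∀ i < c, (T.filter (fun j : Fin (c * m) => (j : ℕ) / m = i)).card = sc)
    (hT : ∀ j ∈ T, ∀ j' ∉ T, (j : ℕ) / m = (j' : ℕ) / m → |x j'| < |x j|) :
    m * (S \ T).card + sc * S.card ≤ m * S.card := by
  rw [card_eq_sum_card_chunk (S \ T), card_eq_sum_card_chunk S, Finset.mul_sum, Finset.mul_sum,
    Finset.mul_sum, ← Finset.sum_add_distrib]
  refine Finset.sum_le_sum fun i hi => ?_
  have hTi := hTcard i (Finset.mem_range.mp hi)
  have hdiff : (S \ T).filter (fun j : Fin (c * m) => (j : ℕ) / m = i) =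
      S.filter (fun j : Fin (c * m) => (j : ℕ) / m = i) \
        T.filter (fun j : Fin (c * m) => (j : ℕ) / m = i) := by
    ext j
    simp only [Finset.mem_sdiff, Finset.mem_filter]
    tauto
  rw [← hTi, hdiff]
  refine mul_card_sdiff_add_le (card_chunk_le hm S i) (hTi.trans_le hscm) ?_
  rintro ⟨p, hp⟩ t ht
  simp only [Finset.mem_sdiff, Finset.mem_filter, not_and] at hp ht ⊢
  refine ⟨?_, ht.2⟩
  by_contra htS
  exact lt_asymm (hS p hp.1.1 t htS)
    (hT t ht.1 p (fun hpT => hp.2 hpT hp.1.2) (ht.2.trans hp.1.2.symm))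

theorem sum_sq_sub_ite_mem {d : ℕ} (x : Fin d → ℝ) (S T : Finset (Fin d)) :
    ∑ j, ((if j ∈ T then x j else 0) - (if j ∈ S then x j else 0)) ^ 2
      = ∑ j ∈ symmDiff S T, x j ^ 2 := by
  rw [← Finset.sum_filter_add_sum_filter_not Finset.univ (· ∈ symmDiff S T),
    Finset.filter_univ_mem, Finset.sum_eq_zero (s := Finset.univ.filter (· ∉ symmDiff S T)),
    add_zero]
  · refine Finset.sum_congr rfl fun j hj => ?_
    rcases Finset.mem_symmDiff.mp hj with ⟨h1, h2⟩ | ⟨h1, h2⟩ <;> simp [h1, h2]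
  · intro j hj
    by_cases h1 : j ∈ S <;> by_cases h2 : j ∈ T <;> simp_all [Finset.mem_symmDiff]

theorem card_symmDiff_of_card_eq {α : Type*} [DecidableEq α] {S T : Finset α}
    (h : S.card = T.card) : (symmDiff S T).card = 2 * (S \ T).card := by
  rw [symmDiff_def, Finset.sup_eq_union, Finset.card_union_of_disjoint disjoint_sdiff_sdiff,
    Finset.card_sdiff_comm h.symm, two_mul]

theorem stmt0 (c m sc : ℕ) (hc : 0 < c) (hm : 0 < m) (hsc : 0 < sc) (hscm : sc ≤ m)
    (G Gt Gt' : Fin (c * m) → ℝ)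
    (hnz : ∀ j, G j ≠ 0)
    (hinj : Function.Injective (fun j => |G j|))
    (hGt : IsSparsify (c * sc) G Gt)
    (hGt' : IsChunkSparsify c m sc G Gt')
    (hbound : ∀ j ∈ symmDiff (supp Gt) (supp Gt'),
      (G j) ^ 2 ≤ (∑ i, (Gt' i) ^ 2) / (c * sc)) :
    ∑ j, (Gt' j - Gt j) ^ 2 ≤ 2 * (1 - (c * sc : ℝ) / (c * m)) * ∑ i, (Gt' i) ^ 2 := by
  obtain ⟨S, hScard, hS, rfl⟩ := hGt
  obtain ⟨T, hTcard, hT, rfl⟩ := hGt'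
  rw [supp_ite_mem hnz, supp_ite_mem hnz] at hbound
  rw [sum_sq_sub_ite_mem]
  set A : ℝ := ∑ i, (if i ∈ T then G i else 0) ^ 2
  have hA : 0 ≤ A := Finset.sum_nonneg fun i _ => sq_nonneg _
  have hTS : S.card = T.card := by
    rw [hScard, card_eq_sum_card_chunk T,
      Finset.sum_congr rfl fun i hi => hTcard i (Finset.mem_range.mp hi)]
    simp
  have hk := mul_card_sdiff_chunk_add_le hm hscm hS hTcard hT
  rw [hScard] at hk
  have hkR : (m : ℝ) * (S \ T).card + sc * (c * sc) ≤ m * (c * sc) := by exact_mod_cast hk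
  have hc' : (0 : ℝ) < c := by exact_mod_cast hc
  have hm' : (0 : ℝ) < m := by exact_mod_cast hm
  have hs' : (0 : ℝ) < sc := by exact_mod_cast hsc
  have hratio : ((S \ T).card : ℝ) / (c * sc) ≤ 1 - (c * sc : ℝ) / (c * m) := by
    rw [mul_div_mul_left _ _ hc'.ne', one_sub_div hm'.ne', div_le_div_iff₀ (by positivity) hm']
    linarith
  calc ∑ j ∈ symmDiff S T, G j ^ 2
      ≤ (symmDiff S T).card • (A / (c * sc)) := Finset.sum_le_card_nsmul _ _ _ hbound
    _ = 2 * (((S \ T).card : ℝ) / (c * sc)) * A := by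
        rw [card_symmDiff_of_card_eq hTS, nsmul_eq_mul]
        push_cast
        ring
    _ ≤ 2 * (1 - (c * sc : ℝ) / (c * m)) * A := by gcongr
end

section
/- Let d = c·m and s = c·s_c for positive integers c, m, s_c with s_c ≤ m, and let G ∈ ℝ^d have all entries nonzero with pairwise distinct absolute values. Let G̃ = Sparsify_s(G) and let G̃' be the chunk-based s-sparsification. For each chunk i, let t_i be the number of indices of supp(G̃) lying in chunk i. Then |supp(G̃) ∩ supp(G̃')| ≥ Σ_{i=1}^{c} min(t_i, s_c). -/
open Finset

theorem stmt4 (c m sc : ℕ) (hc : 0 < c) (hm : 0 < m) (hsc : 0 < sc) (hscm : sc ≤ m)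
    (G Gt Gt' : Fin (c * m) → ℝ)
    (hnz : ∀ j, G j ≠ 0)
    (hinj : Function.Injective (fun j => |G j|))
    (hGt : IsSparsify (c * sc) G Gt)
    (hGt' : IsChunkSparsify c m sc G Gt') :
    ∑ i ∈ Finset.range c,
        min (((supp Gt).filter (fun j : Fin (c * m) => (j : ℕ) / m = i)).card) sc
      ≤ (supp Gt ∩ supp Gt').card := by
  obtain ⟨S, -, hS, rfl⟩ := hGt
  obtain ⟨T, hTcard, hT, rfl⟩ := hGt'
  rw [supp_ite_mem hnz, supp_ite_mem hnz]
  calc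
    _ ≤ ∑ i ∈ Finset.range c,
          ((S ∩ T).filter (fun j : Fin (c * m) => (j : ℕ) / m = i)).card := by
      refine Finset.sum_le_sum fun i hi => ?_
      by_cases hST : S.filter (fun j : Fin (c * m) => (j : ℕ) / m = i) ⊆ T
      · refine (min_le_left _ _).trans (Finset.card_le_card fun j hj => ?_)
        have hjT := hST hj
        simp_all
      · obtain ⟨b, hbS, hbT⟩ := Finset.not_subset.mp hST
        rw [Finset.mem_filter] at hbS
        rw [← hTcard i (Finset.mem_range.mp hi)]
        refine (min_le_right _ _).trans (Finset.card_le_card fun a ha => ?_)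
        rw [Finset.mem_filter] at ha
        have haS : a ∈ S := by
          by_contra haS
          exact lt_asymm (hS b hbS.1 a haS) (hT a ha.1 b hbT (ha.2.trans hbS.2.symm))
        simp [haS, ha.1, ha.2]
    _ = (S ∩ T).card := by
      refine (Finset.card_eq_sum_card_fiberwise fun j _ => ?_).symm
      simpa using Nat.div_lt_of_lt_mul (j.isLt.trans_eq (mul_comm c m))
end

section
/- Let c be a positive integer and let d > 0 and s with 0 < s ≤ d be real numbers. If t_1, …, t_c are nonnegative reals with t_i ≤ d/c for every i and Σ_{i=1}^{c} t_i = s, then Σ_{i=1}^{c} min(t_i, s/c) ≥ s²/d. -/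
theorem stmt5 (c : ℕ) (hc : 0 < c) (d s : ℝ) (hd : 0 < d) (hs : 0 < s) (hsd : s ≤ d)
    (t : Fin c → ℝ) (ht0 : ∀ i, 0 ≤ t i) (htd : ∀ i, t i ≤ d / c)
    (htsum : ∑ i, t i = s) :
    s ^ 2 / d ≤ ∑ i, min (t i) (s / c) := by
  calc s ^ 2 / d = ∑ i, s / d * t i := by
        rw [← Finset.mul_sum, htsum]
        ring
    _ ≤ ∑ i, min (t i) (s / c) := by
        refine Finset.sum_le_sum fun i _ => le_min ?_ ?_
        · exact mul_le_of_le_one_left (ht0 i) ((div_le_one hd).2 hsd)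
        · calc s / d * t i ≤ s / d * (d / c) :=
                mul_le_mul_of_nonneg_left (htd i) (by positivity)
            _ = s / c := div_mul_div_cancel₀ hd.ne'
end

section
/- Let d = c·m and s = c·s_c for positive integers c, m, s_c with s_c ≤ m, and let G ∈ ℝ^d have all entries nonzero with pairwise distinct absolute values. Let G̃ = Sparsify_s(G) and let G̃' be the chunk-based s-sparsification. Then the symmetric difference of the supports satisfies |supp(G̃) Δ supp(G̃')| ≤ 2·s·(1 − s/d). -/
open Finset

theorem card_filter_div_eq_le {n m : ℕ} (hm : 0 < m) (S : Finset (Fin n)) (i : ℕ) :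
    #(S.filter fun j : Fin n => (j : ℕ) / m = i) ≤ m := by
  conv_rhs => rw [← Finset.card_range m]
  refine Finset.card_le_card_of_injOn (fun j => (j : ℕ) % m) ?_ ?_
  · intro j _
    simpa using Nat.mod_lt _ hm
  · intro a ha b hb hab
    simp only [Finset.coe_filter, Set.mem_ofPred_eq] at ha hb
    have hab' : (a : ℕ) % m = (b : ℕ) % m := hab
    apply Fin.ext
    rw [← Nat.div_add_mod (a : ℕ) m, ← Nat.div_add_mod (b : ℕ) m, ha.2, hb.2, hab']

theorem card_eq_sum_card_filter_div {c m : ℕ} (S : Finset (Fin (c * m))) :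
    #S = ∑ i ∈ Finset.range c, #(S.filter fun j : Fin (c * m) => (j : ℕ) / m = i) := by
  refine Finset.card_eq_sum_card_fiberwise fun j _ => ?_
  have h : (j : ℕ) / m < c := Nat.div_lt_of_lt_mul (mul_comm c m ▸ j.isLt)
  simpa using h

/-- The cardinality of the symmetric difference of nested sets of sizes at most `m` is bounded
by the chord of the convex function `k ↦ |k - #B|` on `[0, m]`. -/
theorem mul_card_symmDiff_le {α : Type*} [DecidableEq α] {A B : Finset α} {m : ℕ}
    (hA : #A ≤ m) (hB : #B ≤ m) (h : A ⊆ B ∨ B ⊆ A) :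
    (m : ℝ) * #(symmDiff A B) ≤ m * #B + #A * (m - 2 * #B) := by
  have hA' : (#A : ℝ) ≤ m := by exact_mod_cast hA
  have hB' : (#B : ℝ) ≤ m := by exact_mod_cast hB
  have hA0 : (0 : ℝ) ≤ #A := Nat.cast_nonneg _
  have hB0 : (0 : ℝ) ≤ #B := Nat.cast_nonneg _
  rcases h with h | h
  · rw [symmDiff_of_le h, Finset.cast_card_sdiff h]
    nlinarith [mul_le_mul_of_nonneg_left hB' hA0]
  · rw [symmDiff_of_ge h, Finset.cast_card_sdiff h]
    nlinarith [mul_le_mul_of_nonneg_left hA' hB0]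

theorem stmt6 (c m sc : ℕ) (hc : 0 < c) (hm : 0 < m) (hsc : 0 < sc) (hscm : sc ≤ m)
    (G Gt Gt' : Fin (c * m) → ℝ)
    (hnz : ∀ j, G j ≠ 0)
    (hinj : Function.Injective (fun j => |G j|))
    (hGt : IsSparsify (c * sc) G Gt)
    (hGt' : IsChunkSparsify c m sc G Gt') :
    ((symmDiff (supp Gt) (supp Gt')).card : ℝ)
      ≤ 2 * (c * sc) * (1 - (c * sc : ℝ) / (c * m)) := by
  obtain ⟨S, hScard, hS, rfl⟩ := hGt
  obtain ⟨T, hTcard, hT, rfl⟩ := hGt'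
  rw [supp_ite_mem hnz, supp_ite_mem hnz]
  have hm' : (0 : ℝ) < m := by exact_mod_cast hm
  have hc' : (0 : ℝ) < c := by exact_mod_cast hc
  have hchunk : ∀ i ∈ Finset.range c,
      (m : ℝ) * #((symmDiff S T).filter fun j : Fin (c * m) => (j : ℕ) / m = i)
        ≤ m * sc + #(S.filter fun j : Fin (c * m) => (j : ℕ) / m = i) * (m - 2 * sc) := by
    intro i hi
    have hTi := hTcard i (Finset.mem_range.mp hi)
    have hsymm : ((symmDiff S T).filter fun j : Fin (c * m) => (j : ℕ) / m = i)
        = symmDiff (S.filter fun j : Fin (c * m) => (j : ℕ) / m = i)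
          (T.filter fun j : Fin (c * m) => (j : ℕ) / m = i) := by
      ext j
      simp only [Finset.mem_filter, Finset.mem_symmDiff]
      tauto
    rw [hsymm, ← hTi]
    refine mul_card_symmDiff_le (card_filter_div_eq_le hm S i) (card_filter_div_eq_le hm T i) ?_
    by_contra! hne
    obtain ⟨a, ha, ha'⟩ := Finset.not_subset.mp hne.1
    obtain ⟨b, hb, hb'⟩ := Finset.not_subset.mp hne.2
    simp only [Finset.mem_filter] at ha ha' hb hb'
    exact lt_asymm (hT b hb.1 a (fun h => ha' ⟨h, ha.2⟩) (hb.2.trans ha.2.symm))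
      (hS a ha.1 b fun h => hb' ⟨h, hb.2⟩)
  have hsum := Finset.sum_le_sum hchunk
  rw [← Finset.mul_sum, Finset.sum_add_distrib, Finset.sum_const, Finset.card_range,
    nsmul_eq_mul, ← Finset.sum_mul, ← Nat.cast_sum, ← Nat.cast_sum,
    ← card_eq_sum_card_filter_div, ← card_eq_sum_card_filter_div, hScard, Nat.cast_mul] at hsum
  have hrhs : 2 * (c * sc) * (1 - (c * sc : ℝ) / (c * m))
      = (c * (m * sc) + c * sc * (m - 2 * sc)) / m := by
    field_simp
    ring
  rw [hrhs, le_div_iff₀ hm', mul_comm]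
  exact hsum
end

section
/- Let d = c·m and s = c·s_c for positive integers c, m, s_c with s_c ≤ m, and let G ∈ ℝ^d have entries with pairwise distinct absolute values. Let G̃' be the chunk-based s-sparsification of G. Then ‖G − G̃'‖₂² ≤ (1 − s/d)·‖G‖₂²; that is, chunk-based sparsification with per-chunk budget s_c = s/c satisfies the same contraction factor (1 − s/d) as global top-s sparsification. -/
open Finset

theorem card_mul_sum_le_card_mul_sum {ι : Type*} {A B : Finset ι} {f : ι → ℝ}
    (h : ∀ a ∈ A, ∀ b ∈ B, f b ≤ f a) :
    (A.card : ℝ) * ∑ b ∈ B, f b ≤ B.card * ∑ a ∈ A, f a := by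
  calc (A.card : ℝ) * ∑ b ∈ B, f b = ∑ _a ∈ A, ∑ b ∈ B, f b := by simp
    _ ≤ ∑ a ∈ A, ∑ _b ∈ B, f a :=
        Finset.sum_le_sum fun a ha => Finset.sum_le_sum fun b hb => h a ha b hb
    _ = B.card * ∑ a ∈ A, f a := by simp [Finset.mul_sum]

theorem card_filter_div_eq {c m i : ℕ} (hm : 0 < m) (hi : i < c) :
    (Finset.univ.filter (fun j : Fin (c * m) => (j : ℕ) / m = i)).card = m := by
  have hle : (i + 1) * m ≤ c * m := Nat.mul_le_mul_right m hi
  rw [← Finset.card_map Fin.valEmbedding]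
  have : (Finset.univ.filter (fun j : Fin (c * m) => (j : ℕ) / m = i)).map Fin.valEmbedding
      = Finset.Ico (i * m) ((i + 1) * m) := by
    ext k
    simp only [Finset.mem_map, Finset.mem_filter, Finset.mem_univ, true_and,
      Fin.valEmbedding_apply, Finset.mem_Ico]
    constructor
    · rintro ⟨j, rfl, rfl⟩
      exact ⟨Nat.div_mul_le_self _ _, Nat.lt_mul_of_div_lt (Nat.lt_succ_self _) hm⟩
    · rintro ⟨h₁, h₂⟩
      exact ⟨⟨k, h₂.trans_le hle⟩, Nat.div_eq_of_lt_le h₁ h₂, rfl⟩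
  rw [this, Nat.card_Ico, ← Nat.sub_mul]
  simp

theorem stmt9 (c m sc : ℕ) (hc : 0 < c) (hm : 0 < m) (hsc : 0 < sc) (hscm : sc ≤ m)
    (G Gt' : Fin (c * m) → ℝ)
    (hinj : Function.Injective (fun j => |G j|))
    (hGt' : IsChunkSparsify c m sc G Gt') :
    ∑ j, (G j - Gt' j) ^ 2 ≤ (1 - (c * sc : ℝ) / (c * m)) * ∑ j, (G j) ^ 2 := by
  obtain ⟨S, hcard, htop, rfl⟩ := hGt'
  have hmaps : ∀ j ∈ (Finset.univ : Finset (Fin (c * m))), (j : ℕ) / m ∈ Finset.range c :=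
    fun j _ => Finset.mem_range.2 (Nat.div_lt_of_lt_mul (by simp [mul_comm m]))
  have hc' : (0 : ℝ) < c := by exact_mod_cast hc
  have hm' : (0 : ℝ) < m := by exact_mod_cast hm
  rw [mul_div_mul_left _ _ hc'.ne', ← Finset.sum_fiberwise_of_maps_to hmaps,
    ← Finset.sum_fiberwise_of_maps_to hmaps (fun j => G j ^ 2), Finset.mul_sum]
  refine Finset.sum_le_sum fun i hi => ?_
  rw [Finset.mem_range] at hi
  set C := Finset.univ.filter (fun j : Fin (c * m) => (j : ℕ) / m = i) with hC
  have hA : (C.filter (· ∈ S)).card = sc := by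
    rw [← hcard i hi]
    congr 1
    ext j
    simp [hC, and_comm]
  have hAB : ((C.filter (· ∈ S)).card : ℝ) + (C.filter (· ∉ S)).card = m := by
    have h := Finset.card_filter_add_card_filter_not (s := C) (· ∈ S)
    rw [card_filter_div_eq hm hi] at h
    exact_mod_cast h
  have hsum := Finset.sum_filter_add_sum_filter_not C (· ∈ S) (fun j => G j ^ 2)
  have hres : ∑ j ∈ C, (G j - if j ∈ S then G j else 0) ^ 2
      = ∑ j ∈ C.filter (· ∉ S), G j ^ 2 := by
    rw [Finset.sum_filter (· ∉ S)]
    refine Finset.sum_congr rfl fun j _ => ?_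
    by_cases hj : j ∈ S <;> simp [hj]
  have hle := card_mul_sum_le_card_mul_sum (A := C.filter (· ∈ S)) (B := C.filter (· ∉ S))
    (f := fun j => G j ^ 2) fun a ha b hb => by
      simp only [hC, Finset.mem_filter, Finset.mem_univ, true_and] at ha hb
      exact sq_le_sq.2 (htop a ha.2 b hb.2 (ha.1.trans hb.1.symm)).le
  rw [hA] at hAB hle
  rw [hres, ← hsum, one_sub_div hm'.ne', div_mul_eq_mul_div, le_div_iff₀ hm', ← hAB]
  linarith
end
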